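/- Under Condition (6), for every integer j ≥ 2 and every λ > 0, lim_{t→∞} (ρ_j(λt) − ρ_j(t)) / ((log t)^{jβ+j−1} (ℓ(log t))^j) = (Γ(β+1))^j / Γ(j(β+1)) · log λ. -/

import Mathlib

open Filter Topology

/-- Product weight of a box `r` in generation `j`: `p_r = p_{r 0} ⋯ p_{r (j-1)}`. -/
noncomputable def prodP (p : ℕ → ℝ) (j : ℕ) (r : Fin j → ℕ) : ℝ := ∏ i, p (r i)

/-- Counting function of generation `j`: `ρ_j(x) = #{r ∈ ℕ^j : p_r ≥ 1/x}` (as a real number). -/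
noncomputable def rhoJ (p : ℕ → ℝ) (j : ℕ) (x : ℝ) : ℝ :=
  (Nat.card {r : Fin j → ℕ // 1 / x ≤ prodP p j r} : ℝ)


/-! ### Counting -/

lemma prodP_nonneg {p : ℕ → ℝ} (hp0 : ∀ k, 0 ≤ p k) (j : ℕ) (r : Fin j → ℕ) :
    0 ≤ prodP p j r := Finset.prod_nonneg fun _ _ => hp0 _

lemma prodP_le_one {p : ℕ → ℝ} (hp0 : ∀ k, 0 ≤ p k) (hp : ∀ k, p k ≤ 1) (j : ℕ)
    (r : Fin j → ℕ) : prodP p j r ≤ 1 := Finset.prod_le_one (fun _ _ => hp0 _) fun _ _ => hp _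

lemma prodP_succ (p : ℕ → ℝ) (j : ℕ) (r : Fin (j + 1) → ℕ) :
    prodP p (j + 1) r = p (r 0) * prodP p j (Fin.tail r) := by
  unfold prodP
  rw [Fin.prod_univ_succ]
  rfl

lemma prodP_le_coord {p : ℕ → ℝ} (hp0 : ∀ k, 0 ≤ p k) (hp : ∀ k, p k ≤ 1) (j : ℕ)
    (r : Fin j → ℕ) (i : Fin j) : prodP p j r ≤ p (r i) := by
  unfold prodP
  rw [← Finset.mul_prod_erase _ _ (Finset.mem_univ i)]
  exact mul_le_of_le_one_right (hp0 _) (Finset.prod_le_one (fun _ _ => hp0 _) fun _ _ => hp _)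

lemma fin_level {p : ℕ → ℝ} (hs : Summable p) {c : ℝ} (hc : 0 < c) :
    {k | c ≤ p k}.Finite := by
  have h := hs.tendsto_cofinite_zero.eventually (gt_mem_nhds hc)
  rw [Filter.eventually_cofinite] at h
  simpa using h

lemma fin_prodP {p : ℕ → ℝ} (hp0 : ∀ k, 0 ≤ p k) (hp : ∀ k, p k ≤ 1) (hs : Summable p)
    (j : ℕ) {c : ℝ} (hc : 0 < c) : {r : Fin j → ℕ | c ≤ prodP p j r}.Finite := by
  refine (Set.Finite.pi' (fun _ : Fin j => fin_level hs hc)).subset ?_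
  intro r hr i
  exact le_trans hr (prodP_le_coord hp0 hp j r i)

/-- The counting function in logarithmic scale. -/
noncomputable def NN (p : ℕ → ℝ) (j : ℕ) (y : ℝ) : ℝ := rhoJ p j (Real.exp y)

lemma NN_mono {p : ℕ → ℝ} (hp0 : ∀ k, 0 ≤ p k) (hp : ∀ k, p k ≤ 1) (hs : Summable p)
    (j : ℕ) : Monotone (NN p j) := by
  intro a b hab
  unfold NN rhoJ
  have hb := (fin_prodP hp0 hp hs j (c := 1 / Real.exp b) (by positivity))
  have : Finite {r : Fin j → ℕ // 1 / Real.exp b ≤ prodP p j r} := hb.to_subtype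
  have h : 1 / Real.exp b ≤ 1 / Real.exp a :=
    one_div_le_one_div_of_le (Real.exp_pos _) (Real.exp_le_exp.2 hab)
  exact_mod_cast Nat.card_le_card_of_injective
    (Subtype.map (p := fun r => 1 / Real.exp a ≤ prodP p j r)
      (q := fun r => 1 / Real.exp b ≤ prodP p j r) id (fun r hr => h.trans hr))
      (Subtype.map_injective _ Function.injective_id)

lemma NN_neg {p : ℕ → ℝ} (hp0 : ∀ k, 0 ≤ p k) (hp : ∀ k, p k ≤ 1)
    (j : ℕ) {y : ℝ} (hy : y < 0) : NN p j y = 0 := by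
  unfold NN rhoJ
  have : IsEmpty {r : Fin j → ℕ // 1 / Real.exp y ≤ prodP p j r} := by
    constructor
    rintro ⟨r, hr⟩
    have h1 := hr.trans (prodP_le_one hp0 hp j r)
    rw [div_le_one (Real.exp_pos _)] at h1
    linarith [Real.exp_lt_exp.2 hy, Real.exp_zero]
  rw [Nat.card_of_isEmpty, Nat.cast_zero]

lemma NN_zero (p : ℕ → ℝ) (y : ℝ) : NN p 0 y = if 0 ≤ y then 1 else 0 := by
  unfold NN rhoJ prodP
  split_ifs with h
  · have h2 : (Real.exp y)⁻¹ ≤ 1 := inv_le_one_of_one_le₀ (Real.one_le_exp h)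
    simp [h2]
  · have : IsEmpty {r : Fin 0 → ℕ // 1 / Real.exp y ≤ ∏ i, p (r i)} := by
      constructor
      rintro ⟨r, hr⟩
      simp only [Finset.univ_eq_empty, Finset.prod_empty] at hr
      rw [div_le_one (Real.exp_pos _)] at hr
      linarith [Real.exp_lt_exp.2 (not_le.1 h), Real.exp_zero]
    rw [Nat.card_of_isEmpty, Nat.cast_zero]

lemma NN_succ {p : ℕ → ℝ} (hp0 : ∀ k, 0 ≤ p k) (hp : ∀ k, p k ≤ 1) (hs : Summable p) (T : ℝ) :
    ∃ S : Finset ℕ, ∀ j, ∀ y ≤ T, NN p (j + 1) y = ∑ k ∈ S, NN p j (y - (-Real.log (p k))) := by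
  refine ⟨(fin_level hs (Real.exp_pos (-T))).toFinset, fun j y hy => ?_⟩
  set S := (fin_level hs (Real.exp_pos (-T))).toFinset with hS
  have hmem : ∀ k, k ∈ S ↔ Real.exp (-T) ≤ p k := by intro k; simp [hS]
  have hpos : ∀ k ∈ S, 0 < p k := fun k hk => (Real.exp_pos _).trans_le ((hmem k).1 hk)
  have key : ∀ k : ℕ, 0 < p k → ∀ r : Fin j → ℕ,
      (1 / Real.exp (y - (-Real.log (p k))) ≤ prodP p j r ↔
        1 / Real.exp y ≤ p k * prodP p j r) := by
    intro k hk r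
    rw [sub_neg_eq_add, Real.exp_add, Real.exp_log hk, div_le_iff₀ (by positivity),
      div_le_iff₀ (by positivity)]
    constructor <;> intro h <;> linarith
  let e : {r : Fin (j + 1) → ℕ // 1 / Real.exp y ≤ prodP p (j + 1) r} ≃
      Σ k : S, {r : Fin j → ℕ // 1 / Real.exp (y - (-Real.log (p k))) ≤ prodP p j r} :=
    have aux : ∀ r : {r : Fin (j + 1) → ℕ // 1 / Real.exp y ≤ prodP p (j + 1) r},
        r.1 0 ∈ S := by
      rintro ⟨r, hr⟩
      rw [hmem]
      refine le_trans ?_ (hr.trans (prodP_le_coord hp0 hp _ r 0))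
      rw [one_div, ← Real.exp_neg]
      exact Real.exp_le_exp.2 (by linarith)
    { toFun := fun r => ⟨⟨r.1 0, aux r⟩, ⟨Fin.tail r.1, by
        rw [key _ (hpos _ (aux r)), ← prodP_succ]; exact r.2⟩⟩
      invFun := fun s => ⟨Fin.cons s.1.1 s.2.1, by
        rw [prodP_succ, Fin.cons_zero, Fin.tail_cons, ← key _ (hpos _ s.1.2)]; exact s.2.2⟩
      left_inv := by
        rintro ⟨r, hr⟩
        simp
      right_inv := by
        rintro ⟨⟨k, hk⟩, ⟨r, hr⟩⟩
        rfl }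
  have hfin : ∀ k : S, Finite
      {r : Fin j → ℕ // 1 / Real.exp (y - (-Real.log (p k))) ≤ prodP p j r} :=
    fun k => (fin_prodP hp0 hp hs j (by positivity)).to_subtype
  unfold NN rhoJ
  rw [Nat.card_congr e, Nat.card_sigma]
  push_cast
  exact Finset.sum_coe_sort S
    (fun k => (Nat.card {r : Fin j → ℕ // 1 / Real.exp (y - (-Real.log (p k))) ≤ prodP p j r} : ℝ))

/-! ### Convolution inequalities -/

lemma incr_integrableOn {F : ℝ → ℝ} (hF : Monotone F) (y h u v : ℝ) :
    MeasureTheory.IntegrableOn (fun x => F (y - x + h) - F (y - x)) (Set.Ico u v) := by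
  have h1 : Antitone (fun x => F (y - x + h)) := fun s t hst => hF (by linarith)
  have h2 : Antitone (fun x => F (y - x)) := fun s t hst => hF (by linarith)
  have h3 := (h1.locallyIntegrable (μ := MeasureTheory.volume)).integrableOn_isCompact
    (isCompact_Icc (a := u) (b := v))
  have h4 := (h2.locallyIntegrable (μ := MeasureTheory.volume)).integrableOn_isCompact
    (isCompact_Icc (a := u) (b := v))
  exact (h3.sub h4).mono_set Set.Ico_subset_Icc_self

lemma conv_upper {a : ℕ → ℝ} {N1 F G : ℝ → ℝ} (hF : Monotone F) (hF0 : ∀ y < 0, F y = 0)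
    (hrec : ∀ T, ∃ S : Finset ℕ, ∀ y ≤ T, N1 y = ∑ k ∈ S, (if 0 ≤ y - a k then (1 : ℝ) else 0) ∧
      G y = ∑ k ∈ S, F (y - a k)) {h δ : ℝ} (hh : 0 ≤ h) (hδ : 0 < δ) (y : ℝ) :
    ∫ x, (F (y - x + h) - F (y - x)) * (N1 (x + δ) - N1 x) ≤ δ * (G (y + h + δ) - G y) := by
  obtain ⟨S, hS⟩ := hrec (y + h + δ)
  have hInt : ∀ k ∈ S, MeasureTheory.Integrable
      ((Set.Ico (a k - δ) (a k)).indicator (fun x => F (y - x + h) - F (y - x))) := fun k _ =>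
    (MeasureTheory.integrable_indicator_iff measurableSet_Ico).2 (incr_integrableOn hF _ _ _ _)
  have hfun : (fun x => (F (y - x + h) - F (y - x)) * (N1 (x + δ) - N1 x)) =
      fun x => ∑ k ∈ S,
        (Set.Ico (a k - δ) (a k)).indicator (fun x => F (y - x + h) - F (y - x)) x := by
    funext x
    by_cases hx : x ≤ y + h
    · rw [(hS (x + δ) (by linarith)).1, (hS x (by linarith)).1, ← Finset.sum_sub_distrib,
        Finset.mul_sum]
      refine Finset.sum_congr rfl fun k _ => ?_
      simp only [Set.indicator, Set.mem_Ico]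
      split_ifs <;> first | (exfalso; grind) | simp
    · push Not at hx
      rw [hF0 _ (by linarith), hF0 _ (by linarith)]
      simp only [sub_self, zero_mul]
      refine (Finset.sum_eq_zero fun k _ => ?_).symm
      simp only [Set.indicator]
      split_ifs
      · rw [hF0 _ (by linarith), hF0 _ (by linarith), sub_self]
      · rfl
  rw [hfun, MeasureTheory.integral_finsetSum _ hInt, (hS _ le_rfl).2, (hS y (by linarith)).2,
    ← Finset.sum_sub_distrib, Finset.mul_sum]
  refine Finset.sum_le_sum fun k _ => ?_
  rw [MeasureTheory.integral_indicator measurableSet_Ico]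
  calc _ ≤ ∫ x in Set.Ico (a k - δ) (a k), (F (y + h + δ - a k) - F (y - a k)) := by
        refine MeasureTheory.setIntegral_mono_on (incr_integrableOn hF _ _ _ _) (by simp)
          measurableSet_Ico fun x hx => ?_
        have h1 := hF (show y - x + h ≤ y + h + δ - a k by linarith [hx.1])
        have h2 := hF (show y - a k ≤ y - x by linarith [hx.2])
        linarith
    _ = _ := by simp [hδ.le]

lemma conv_lower {a : ℕ → ℝ} {N1 F G : ℝ → ℝ} (hF : Monotone F) (hF0 : ∀ y < 0, F y = 0)
    (hrec : ∀ T, ∃ S : Finset ℕ, ∀ y ≤ T, N1 y = ∑ k ∈ S, (if 0 ≤ y - a k then (1 : ℝ) else 0) ∧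
      G y = ∑ k ∈ S, F (y - a k)) {h δ : ℝ} (hh : 0 ≤ h) (hδ : 0 < δ) (y : ℝ) :
    δ * (G (y + h - δ) - G y) ≤ ∫ x, (F (y - x + h) - F (y - x)) * (N1 x - N1 (x - δ)) := by
  obtain ⟨S, hS⟩ := hrec (y + h + δ)
  have hInt : ∀ k ∈ S, MeasureTheory.Integrable
      ((Set.Ico (a k) (a k + δ)).indicator (fun x => F (y - x + h) - F (y - x))) := fun k _ =>
    (MeasureTheory.integrable_indicator_iff measurableSet_Ico).2 (incr_integrableOn hF _ _ _ _)
  have hfun : (fun x => (F (y - x + h) - F (y - x)) * (N1 x - N1 (x - δ))) =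
      fun x => ∑ k ∈ S,
        (Set.Ico (a k) (a k + δ)).indicator (fun x => F (y - x + h) - F (y - x)) x := by
    funext x
    by_cases hx : x ≤ y + h
    · rw [(hS (x - δ) (by linarith)).1, (hS x (by linarith)).1, ← Finset.sum_sub_distrib,
        Finset.mul_sum]
      refine Finset.sum_congr rfl fun k _ => ?_
      simp only [Set.indicator, Set.mem_Ico]
      split_ifs <;> first | (exfalso; grind) | simp
    · push Not at hx
      rw [hF0 _ (by linarith), hF0 _ (by linarith)]
      simp only [sub_self, zero_mul]
      refine (Finset.sum_eq_zero fun k _ => ?_).symm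
      simp only [Set.indicator]
      split_ifs
      · rw [hF0 _ (by linarith), hF0 _ (by linarith), sub_self]
      · rfl
  rw [hfun, MeasureTheory.integral_finsetSum _ hInt, (hS (y + h - δ) (by linarith)).2,
    (hS y (by linarith)).2, ← Finset.sum_sub_distrib, Finset.mul_sum]
  refine Finset.sum_le_sum fun k _ => ?_
  rw [MeasureTheory.integral_indicator measurableSet_Ico]
  calc _ = ∫ x in Set.Ico (a k) (a k + δ), (F (y + h - δ - a k) - F (y - a k)) := by
        simp [hδ.le]
    _ ≤ _ := by
        refine MeasureTheory.setIntegral_mono_on (by simp) (incr_integrableOn hF _ _ _ _)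
          measurableSet_Ico fun x hx => ?_
        have h1 := hF (show y + h - δ - a k ≤ y - x + h by linarith [hx.2])
        have h2 := hF (show y - x ≤ y - a k by linarith [hx.1])
        linarith

lemma beta_int {u v : ℝ} (hu : 0 ≤ u) (hv : 0 ≤ v) :
    ∫ s in Set.Ioo (0 : ℝ) 1, s ^ u * (1 - s) ^ v =
      Real.Gamma (u + 1) * Real.Gamma (v + 1) / Real.Gamma (u + 1 + (v + 1)) := by
  have h := ProbabilityTheory.beta_eq_betaIntegralReal (u + 1) (v + 1) (by linarith) (by linarith)
  unfold ProbabilityTheory.beta at h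
  rw [h, Complex.betaIntegral, intervalIntegral.integral_of_le zero_le_one,
    MeasureTheory.integral_Ioc_eq_integral_Ioo]
  rw [← Complex.ofReal_re (∫ s in Set.Ioo (0 : ℝ) 1, s ^ u * (1 - s) ^ v), ← integral_complex_ofReal]
  congr 1
  refine MeasureTheory.setIntegral_congr_fun measurableSet_Ioo fun s hs => ?_
  have h1 : 0 ≤ 1 - s := by linarith [hs.2]
  simp only [Complex.ofReal_mul, Complex.ofReal_add, Complex.ofReal_one, add_sub_cancel_right]
  rw [Complex.ofReal_cpow hs.1.le, Complex.ofReal_cpow h1]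
  simp

/-- The asymptotics of a convolution, by dominated convergence. -/
lemma conv_asymp {A B g1 g2 : ℝ → ℝ} {H α b u v : ℝ} (hu : 0 ≤ u) (hv : 0 ≤ v)
    (mA : Measurable A) (mB : Measurable B) (A0 : ∀ x, 0 ≤ A x) (B0 : ∀ x, 0 ≤ B x)
    (sA : ∀ x < -H, A x = 0) (sB : ∀ x < -H, B x = 0)
    (g1p : ∀ᶠ y in atTop, 0 < g1 y) (g2p : ∀ᶠ y in atTop, 0 < g2 y)
    (lA : ∀ s > 0, Tendsto (fun y => A (y * s) / g1 y) atTop (𝓝 (α * s ^ u)))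
    (lB : ∀ s > 0, Tendsto (fun y => B (y * s) / g2 y) atTop (𝓝 (b * s ^ v)))
    (dA : ∃ C, ∀ᶠ y in atTop, ∀ z ≤ 2 * y, A z ≤ C * g1 y)
    (dB : ∃ C, ∀ᶠ y in atTop, ∀ z ≤ 2 * y, B z ≤ C * g2 y) :
    Tendsto (fun y => (∫ x, B (y - x) * A x) / (y * g1 y * g2 y)) atTop
      (𝓝 (α * b * (Real.Gamma (u + 1) * Real.Gamma (v + 1) / Real.Gamma (u + 1 + (v + 1))))) := by
  obtain ⟨C1, dA⟩ := dA
  obtain ⟨C2, dB⟩ := dB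
  have key : Tendsto (fun y => ∫ s, (B (y * (1 - s)) / g2 y) * (A (y * s) / g1 y)) atTop
      (𝓝 (∫ s, (Set.Ioo (0 : ℝ) 1).indicator (fun s => α * b * (s ^ u * (1 - s) ^ v)) s)) := by
    refine MeasureTheory.tendsto_integral_filter_of_dominated_convergence
      ((Set.Icc (-1 : ℝ) 2).indicator (fun _ => C2 * C1)) ?_ ?_ ?_ ?_
    · refine Eventually.of_forall fun y => Measurable.aestronglyMeasurable ?_
      exact ((mB.comp (by fun_prop)).div_const _).mul ((mA.comp (by fun_prop)).div_const _)
    · filter_upwards [g1p, g2p, dA, dB, eventually_gt_atTop H, eventually_gt_atTop 0]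
        with y h1 h2 h3 h4 h5 h6
      refine Eventually.of_forall fun s => ?_
      have hb0 : 0 ≤ B (y * (1 - s)) / g2 y := div_nonneg (B0 _) h2.le
      have ha0 : 0 ≤ A (y * s) / g1 y := div_nonneg (A0 _) h1.le
      rw [Real.norm_of_nonneg (mul_nonneg hb0 ha0)]
      by_cases hs : s ∈ Set.Icc (-1 : ℝ) 2
      · rw [Set.indicator_of_mem hs]
        have e1 : A (y * s) / g1 y ≤ C1 := by
          rw [div_le_iff₀ h1]; exact h3 _ (by nlinarith [hs.2])
        have e2 : B (y * (1 - s)) / g2 y ≤ C2 := by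
          rw [div_le_iff₀ h2]; exact h4 _ (by nlinarith [hs.1])
        exact mul_le_mul e2 e1 ha0 (hb0.trans e2)
      · rw [Set.indicator_of_notMem hs]
        rw [Set.mem_Icc, not_and_or, not_le, not_le] at hs
        rcases hs with hs | hs
        · rw [sA (y * s) (by nlinarith)]; simp
        · rw [sB (y * (1 - s)) (by nlinarith)]; simp
    · exact (MeasureTheory.integrable_indicator_iff measurableSet_Icc).2
        continuous_const.integrableOn_Icc
    · have h0 : ∀ᵐ s : ℝ, s ≠ 0 := by simp [MeasureTheory.ae_iff]
      have h1 : ∀ᵐ s : ℝ, s ≠ 1 := by simp [MeasureTheory.ae_iff]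
      filter_upwards [h0, h1] with s h0 h1
      have hz : ∀ c : ℝ, c < 0 → ∀ᶠ y : ℝ in atTop, y * c < -H := fun c hc =>
        (tendsto_id.atTop_mul_const_of_neg hc).eventually (eventually_lt_atBot (-H))
      rcases lt_or_gt_of_ne h0 with h | h
      · rw [Set.indicator_of_notMem (fun hm => by linarith [hm.1])]
        refine tendsto_const_nhds.congr' ?_
        filter_upwards [hz s h] with y hy
        rw [sA _ hy]; simp
      · rcases lt_or_gt_of_ne h1 with h' | h'
        · rw [Set.indicator_of_mem (show s ∈ Set.Ioo (0 : ℝ) 1 from ⟨h, h'⟩)]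
          have := (lB (1 - s) (by linarith)).mul (lA s h)
          convert this using 2
          ring
        · rw [Set.indicator_of_notMem (fun hm => by linarith [hm.2])]
          refine tendsto_const_nhds.congr' ?_
          filter_upwards [hz (1 - s) (by linarith)] with y hy
          rw [sB _ hy]; simp
  rw [MeasureTheory.integral_indicator measurableSet_Ioo, MeasureTheory.integral_const_mul,
    beta_int hu hv] at key
  refine key.congr' ?_
  filter_upwards [g1p, g2p, eventually_gt_atTop 0] with y h1 h2 h6
  have e := MeasureTheory.Measure.integral_comp_mul_left (fun x => B (y - x) * A x) y
  have e2 : ∫ s, (B (y * (1 - s)) / g2 y) * (A (y * s) / g1 y) =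
      (∫ s, B (y - y * s) * A (y * s)) / (g1 y * g2 y) := by
    rw [← MeasureTheory.integral_div]
    congr 1
    funext s
    rw [mul_sub, mul_one]
    field_simp
  rw [e2, e, abs_of_pos (inv_pos.2 h6), smul_eq_mul]
  field_simp

/-! ### The induction step -/

/-- Local regularity of the increments of a counting function `N` with gauge `g`. -/
structure Good (N g : ℝ → ℝ) (γ c : ℝ) : Prop where
  mono : Monotone N
  zero : ∀ y < 0, N y = 0
  gpos : ∀ᶠ y in atTop, 0 < g y
  lim : ∀ h > 0, Tendsto (fun y => (N (y + h) - N y) / g y) atTop (𝓝 (c * h))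
  rv : ∀ s > 0, Tendsto (fun y => g (y * s) / g y) atTop (𝓝 (s ^ γ))
  dom : ∀ h > 0, ∀ K > 0, ∃ C, 0 ≤ C ∧ ∀ᶠ y in atTop, ∀ z ≤ K * y, N (z + h) - N z ≤ C * g y

lemma scale_lim {A g : ℝ → ℝ} {α u : ℝ} (gpos : ∀ᶠ y in atTop, 0 < g y)
    (hA : Tendsto (fun y => A y / g y) atTop (𝓝 α))
    (rv : ∀ s > 0, Tendsto (fun y => g (y * s) / g y) atTop (𝓝 (s ^ u))) (s : ℝ) (hs : 0 < s) :
    Tendsto (fun y => A (y * s) / g y) atTop (𝓝 (α * s ^ u)) := by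
  have ht : Tendsto (fun y : ℝ => y * s) atTop atTop := tendsto_id.atTop_mul_const hs
  refine ((hA.comp ht).mul (rv s hs)).congr' ?_
  filter_upwards [ht.eventually gpos] with y hy
  simp only [Function.comp]
  field_simp

lemma Good.step {a : ℕ → ℝ} {N1 F G g1 g2 : ℝ → ℝ} {β γ c : ℝ} (hβ : 0 ≤ β) (hγ : 0 ≤ γ)
    (h1 : Good N1 g1 β 1)
    (h1' : ∀ δ > 0, Tendsto (fun y => (N1 y - N1 (y - δ)) / g1 y) atTop (𝓝 δ))
    (h2 : Good F g2 γ c) (hG : Monotone G) (hG0 : ∀ y < 0, G y = 0)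
    (hrec : ∀ T, ∃ S : Finset ℕ, ∀ y ≤ T, N1 y = ∑ k ∈ S, (if 0 ≤ y - a k then (1 : ℝ) else 0) ∧
      G y = ∑ k ∈ S, F (y - a k)) :
    Good G (fun y => y * g1 y * g2 y) (β + γ + 1)
      (c * (Real.Gamma (β + 1) * Real.Gamma (γ + 1) / Real.Gamma (β + 1 + (γ + 1)))) := by
  set b := Real.Gamma (β + 1) * Real.Gamma (γ + 1) / Real.Gamma (β + 1 + (γ + 1)) with hb
  have hb0 : 0 ≤ b := by
    have := Real.Gamma_pos_of_pos (show 0 < β + 1 by linarith)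
    have := Real.Gamma_pos_of_pos (show 0 < γ + 1 by linarith)
    have := Real.Gamma_pos_of_pos (show 0 < β + 1 + (γ + 1) by linarith)
    positivity
  have gpos : ∀ᶠ y in atTop, 0 < y * g1 y * g2 y := by
    filter_upwards [h1.gpos, h2.gpos, eventually_gt_atTop 0] with y e1 e2 e3
    positivity
  have m1 := h1.mono.measurable
  have m2 := h2.mono.measurable
  have dB : ∀ h > 0, ∃ C, ∀ᶠ y in atTop, ∀ z ≤ 2 * y, F (z + h) - F z ≤ C * g2 y := by
    intro h hh
    obtain ⟨C, _, hC⟩ := h2.dom h hh 2 (by norm_num)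
    exact ⟨C, hC⟩
  -- the two integral asymptotics
  have I1 : ∀ h > 0, ∀ δ > 0, Tendsto (fun y =>
      (∫ x, (F (y - x + h) - F (y - x)) * (N1 (x + δ) - N1 x)) / (y * g1 y * g2 y)) atTop
      (𝓝 (δ * (c * h) * b)) := by
    intro h hh δ hδ
    refine conv_asymp (A := fun x => N1 (x + δ) - N1 x) (B := fun z => F (z + h) - F z)
      (H := h + δ) hβ hγ ((m1.comp (by fun_prop)).sub m1) ((m2.comp (by fun_prop)).sub m2)
      (fun x => sub_nonneg.2 (h1.mono (by linarith))) (fun x => sub_nonneg.2 (h2.mono (by linarith)))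
      ?_ ?_ h1.gpos h2.gpos ?_ ?_ ?_ (dB h hh)
    · intro x hx
      rw [h1.zero _ (by linarith), h1.zero _ (by linarith), sub_self]
    · intro x hx
      rw [h2.zero _ (by linarith), h2.zero _ (by linarith), sub_self]
    · have := h1.lim δ hδ
      rw [one_mul] at this
      exact scale_lim h1.gpos this h1.rv
    · exact scale_lim h2.gpos (h2.lim h hh) h2.rv
    · obtain ⟨C, _, hC⟩ := h1.dom δ hδ 2 (by norm_num)
      exact ⟨C, hC⟩
  have I2 : ∀ h > 0, ∀ δ > 0, Tendsto (fun y =>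
      (∫ x, (F (y - x + h) - F (y - x)) * (N1 x - N1 (x - δ))) / (y * g1 y * g2 y)) atTop
      (𝓝 (δ * (c * h) * b)) := by
    intro h hh δ hδ
    refine conv_asymp (A := fun x => N1 x - N1 (x - δ)) (B := fun z => F (z + h) - F z)
      (H := h + δ) hβ hγ (m1.sub (m1.comp (by fun_prop))) ((m2.comp (by fun_prop)).sub m2)
      (fun x => sub_nonneg.2 (h1.mono (by linarith))) (fun x => sub_nonneg.2 (h2.mono (by linarith)))
      ?_ ?_ h1.gpos h2.gpos ?_ ?_ ?_ (dB h hh)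
    · intro x hx
      rw [h1.zero _ (by linarith), h1.zero _ (by linarith), sub_self]
    · intro x hx
      rw [h2.zero _ (by linarith), h2.zero _ (by linarith), sub_self]
    · exact scale_lim (A := fun x => N1 x - N1 (x - δ)) h1.gpos (h1' δ hδ) h1.rv
    · exact scale_lim h2.gpos (h2.lim h hh) h2.rv
    · obtain ⟨C, _, hC⟩ := h1.dom δ hδ 2 (by norm_num)
      refine ⟨C, ?_⟩
      filter_upwards [hC] with y hy z hz
      have := hy (z - δ) (by linarith)
      rwa [sub_add_cancel] at this
  refine ⟨hG, hG0, gpos, ?_, ?_, ?_⟩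
  · intro h hh
    have cont : ∀ e : ℝ, Tendsto (fun δ : ℝ => c * b * (h + e * δ)) (𝓝[>] 0) (𝓝 (c * b * h)) := by
      intro e
      have : Continuous (fun δ : ℝ => c * b * (h + e * δ)) := by fun_prop
      have h3 := (this.tendsto 0).mono_left (nhdsWithin_le_nhds (s := Set.Ioi 0))
      simpa using h3
    have hev : ∀ᶠ δ : ℝ in 𝓝[>] 0, 0 < δ ∧ δ < h := Ioo_mem_nhdsGT hh
    rw [show c * b * h = c * b * h from rfl]
    rw [tendsto_order]
    constructor
    · intro x hx
      obtain ⟨δ, hδx, hδ0, hδh⟩ := (((cont (-1)).eventually (lt_mem_nhds hx)).and hev).exists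
      have h3 := (I1 (h - δ) (by linarith) δ hδ0).eventually
        (lt_mem_nhds (show δ * x < δ * (c * (h - δ)) * b by nlinarith))
      filter_upwards [h3, gpos] with y h3 gp
      have h4 := conv_upper h2.mono h2.zero hrec (h := h - δ) (by linarith) hδ0 y
      rw [show y + (h - δ) + δ = y + h by ring] at h4
      rw [lt_div_iff₀ gp] at h3 ⊢
      have h5 := h3.trans_le h4
      rw [mul_assoc] at h5
      exact lt_of_mul_lt_mul_left h5 hδ0.le
    · intro x hx
      obtain ⟨δ, hδx, hδ0, hδh⟩ := (((cont 1).eventually (gt_mem_nhds hx)).and hev).exists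
      have h3 := (I2 (h + δ) (by linarith) δ hδ0).eventually
        (gt_mem_nhds (show δ * (c * (h + δ)) * b < δ * x by nlinarith))
      filter_upwards [h3, gpos] with y h3 gp
      have h4 := conv_lower h2.mono h2.zero hrec (h := h + δ) (by linarith) hδ0 y
      rw [show y + (h + δ) - δ = y + h by ring] at h4
      rw [div_lt_iff₀ gp] at h3 ⊢
      have h5 := h4.trans_lt h3
      rw [mul_assoc] at h5
      exact lt_of_mul_lt_mul_left h5 hδ0.le
  · intro s hs
    have h3 := ((h1.rv s hs).mul (h2.rv s hs)).mul_const s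
    rw [Real.rpow_add hs, Real.rpow_add hs, Real.rpow_one]
    refine h3.congr' ?_
    filter_upwards [h1.gpos, h2.gpos, eventually_gt_atTop 0] with y e1 e2 e3
    field_simp
  · intro h hh K hK
    obtain ⟨C1, hC1, d1⟩ := h1.dom 1 one_pos (K + 1) (by linarith)
    obtain ⟨C2, hC2, d2⟩ := h2.dom (h + 1) (by linarith) K hK
    refine ⟨(K + 1) * (C1 * C2), by positivity, ?_⟩
    filter_upwards [d1, d2, h1.gpos, h2.gpos, eventually_gt_atTop (h + 1)] with y d1 d2 e1 e2 e3 z hz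
    have hy0 : 0 < y := by linarith
    have h4 := conv_lower h2.mono h2.zero hrec (h := h + 1) (by linarith) one_pos z
    rw [show z + (h + 1) - 1 = z + h by ring, one_mul] at h4
    refine h4.trans ?_
    have hle : ∀ x, (F (z - x + (h + 1)) - F (z - x)) * (N1 x - N1 (x - 1)) ≤
        (Set.Icc 0 ((K + 1) * y)).indicator (fun _ => (C2 * g2 y) * (C1 * g1 y)) x := by
      intro x
      by_cases hx : x ∈ Set.Icc 0 ((K + 1) * y)
      · rw [Set.indicator_of_mem hx]
        have f1 := d1 (x - 1) (by linarith [hx.2])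
        rw [sub_add_cancel] at f1
        have f2 := d2 (z - x) (by linarith [hx.1])
        exact mul_le_mul f2 f1 (sub_nonneg.2 (h1.mono (by linarith))) (by positivity)
      · rw [Set.indicator_of_notMem hx]
        rw [Set.mem_Icc, not_and_or, not_le, not_le] at hx
        rcases hx with hx | hx
        · rw [h1.zero _ hx, h1.zero _ (by linarith)]; simp
        · rw [h2.zero (z - x + (h + 1)) (by linarith), h2.zero (z - x) (by linarith)]; simp
    refine (MeasureTheory.integral_mono_of_nonneg (Eventually.of_forall fun x =>
      mul_nonneg (sub_nonneg.2 (h2.mono (by linarith))) (sub_nonneg.2 (h1.mono (by linarith))))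
      ((MeasureTheory.integrable_indicator_iff measurableSet_Icc).2
        continuous_const.integrableOn_Icc) (Eventually.of_forall hle)).trans ?_
    rw [MeasureTheory.integral_indicator measurableSet_Icc, MeasureTheory.setIntegral_const]
    simp only [Real.volume_real_Icc, smul_eq_mul, sub_zero]
    rw [max_eq_left (by positivity)]
    apply le_of_eq
    ring

/-! ### The base case -/

lemma rv_bound_near {U : ℝ → ℝ} {β : ℝ} (hβ : 0 ≤ β) (mU : Measurable U)
    (Upos : ∀ᶠ y in atTop, 0 < U y)
    (rv : ∀ s > 0, Tendsto (fun y => U (y * s) / U y) atTop (𝓝 (s ^ β))) :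
    ∃ C > 0, ∃ Y > 0, ∀ y z, Y ≤ y → y ≤ z → z ≤ 2 * y → U z ≤ C * U y := by
  set M : ℝ := 4 ^ β + 1 with hM
  have hMpos : 0 < M := by positivity
  let Bad : ℝ → Set ℝ := fun y =>
    Set.Icc 1 4 ∩ ({s | U (y * s) < 1 / 2 * U y} ∪ {s | M * U y < U (y * s)})
  have hmeas : ∀ y, MeasurableSet (Bad y) := fun y =>
    measurableSet_Icc.inter ((measurableSet_lt (mU.comp (by fun_prop)) measurable_const).union
      (measurableSet_lt measurable_const (mU.comp (by fun_prop))))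
  have hlim : Tendsto (fun y => MeasureTheory.volume (Bad y)) atTop
      (𝓝 (MeasureTheory.volume (∅ : Set ℝ))) := by
    refine MeasureTheory.tendsto_measure_of_tendsto_indicator atTop hmeas
      (B := Set.Icc 1 4) measurableSet_Icc (by simp) (Eventually.of_forall fun y =>
        Set.inter_subset_left) ?_
    intro s
    by_cases hs : s ∈ Set.Icc (1 : ℝ) 4
    · have hs0 : 0 < s := by linarith [hs.1]
      have e1 : (1 / 2 : ℝ) < s ^ β := by
        have := Real.one_le_rpow hs.1 hβ
        linarith
      have e2 : s ^ β < M := by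
        have := Real.rpow_le_rpow hs0.le hs.2 hβ
        linarith
      filter_upwards [Upos, (rv s hs0).eventually (lt_mem_nhds e1),
        (rv s hs0).eventually (gt_mem_nhds e2)] with y hy f1 f2
      rw [lt_div_iff₀ hy] at f1
      rw [div_lt_iff₀ hy] at f2
      simp only [Set.mem_empty_iff_false, iff_false]
      rintro ⟨_, h | h⟩
      · exact lt_asymm h f1
      · exact lt_asymm h f2
    · refine Eventually.of_forall fun y => ?_
      simp only [Set.mem_empty_iff_false, iff_false]
      exact fun h => hs h.1
  rw [MeasureTheory.measure_empty] at hlim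
  have hev := hlim.eventually (gt_mem_nhds (show (0 : ENNReal) < ENNReal.ofReal (1 / 4) by simp))
  obtain ⟨Y, hY⟩ := eventually_atTop.1 (hev.and Upos)
  refine ⟨2 * M, by positivity, max Y 1, by positivity, fun y z hy hyz hzy => ?_⟩
  have hy1 : 1 ≤ y := (le_max_right _ _).trans hy
  have hyY : Y ≤ y := (le_max_left _ _).trans hy
  have hy0 : 0 < y := by linarith
  have hz0 : 0 < z := by linarith
  have v1 := (hY y hyY).1
  have v2 := (hY z (hyY.trans hyz)).1
  have v3 : MeasureTheory.volume ((fun s => s * (y / z)) ⁻¹' (Bad z)) ≤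
      ENNReal.ofReal (1 / 2) := by
    rw [Real.volume_preimage_mul_right (by positivity)]
    calc _ ≤ ENNReal.ofReal 2 * ENNReal.ofReal (1 / 4) := by
          refine mul_le_mul' (ENNReal.ofReal_le_ofReal ?_) v2.le
          rw [abs_of_pos (by positivity), inv_div, div_le_iff₀ hy0]
          exact hzy
      _ = _ := by
          rw [← ENNReal.ofReal_mul (by norm_num)]; norm_num
  obtain ⟨s, hs, hns⟩ : ∃ s ∈ Set.Icc (2 : ℝ) 4,
      s ∉ Bad y ∪ (fun s => s * (y / z)) ⁻¹' (Bad z) := by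
    by_contra hcon
    push Not at hcon
    have h1 := MeasureTheory.measure_mono (μ := MeasureTheory.volume)
      (show Set.Icc (2 : ℝ) 4 ⊆ _ from hcon)
    have h2 := h1.trans ((MeasureTheory.measure_union_le _ _).trans (add_le_add v1.le v3))
    rw [Real.volume_Icc, ← ENNReal.ofReal_add (by norm_num) (by norm_num),
      ENNReal.ofReal_le_ofReal_iff (by norm_num)] at h2
    norm_num at h2
  rw [Set.mem_union, not_or] at hns
  have f1 : U (y * s) ≤ M * U y := by
    by_contra hcon
    exact hns.1 ⟨⟨by linarith [hs.1], hs.2⟩, Or.inr (not_le.1 hcon)⟩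
  have f2 : 1 / 2 * U z ≤ U (y * s) := by
    by_contra hcon
    have e : z * (s * (y / z)) = y * s := by field_simp
    refine hns.2 ⟨⟨?_, ?_⟩, Or.inl ?_⟩
    · show 1 ≤ s * (y / z)
      rw [mul_div_assoc', le_div_iff₀ hz0]
      nlinarith [hs.1]
    · show s * (y / z) ≤ 4
      rw [mul_div_assoc', div_le_iff₀ hz0]
      nlinarith [hs.2]
    · show U (z * (s * (y / z))) < _
      rw [e]
      exact not_le.1 hcon
  linarith

lemma rv_bound {U : ℝ → ℝ} {β : ℝ} (hβ : 0 < β) (mU : Measurable U)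
    (Upos : ∀ᶠ y in atTop, 0 < U y)
    (rv : ∀ s > 0, Tendsto (fun y => U (y * s) / U y) atTop (𝓝 (s ^ β))) :
    ∃ C > 0, ∃ Y > 0, ∀ z y, Y ≤ z → z ≤ y → U z ≤ C * U y := by
  obtain ⟨C, hC, Y, hY, hb⟩ := rv_bound_near hβ.le mU Upos rv
  have h2 : ∀ᶠ y in atTop, U y ≤ U (y * 2) := by
    filter_upwards [Upos, (rv 2 two_pos).eventually
      (lt_mem_nhds (Real.one_lt_rpow one_lt_two hβ))] with y hy f1
    rw [lt_div_iff₀ hy] at f1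
    linarith
  obtain ⟨Y', hY'⟩ := eventually_atTop.1 h2
  refine ⟨C, hC, max Y Y', lt_max_of_lt_left hY, fun z y hz hzy => ?_⟩
  have hz0 : 0 < z := (lt_max_of_lt_left hY).trans_le hz
  have hzY : Y ≤ z := (le_max_left _ _).trans hz
  have hzY' : Y' ≤ z := (le_max_right _ _).trans hz
  have hpow : ∀ n : ℕ, U z ≤ U (z * 2 ^ n) := by
    intro n
    induction n with
    | zero => simp
    | succ n ih =>
      rw [pow_succ, ← mul_assoc]
      refine ih.trans (hY' _ (hzY'.trans ?_))
      exact le_mul_of_one_le_right hz0.le (one_le_pow₀ one_le_two)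
  obtain ⟨n, hn1, hn2⟩ := exists_nat_pow_near (x := y / z) (y := (2 : ℝ))
    (by rw [le_div_iff₀ hz0]; linarith) one_lt_two
  rw [le_div_iff₀ hz0] at hn1
  rw [div_lt_iff₀ hz0] at hn2
  refine (hpow (n + 1)).trans (hb y _ (hzY.trans hzy) (by linarith) ?_)
  rw [pow_succ]
  linarith

lemma good_base {N g : ℝ → ℝ} {β : ℝ} (hβ : 0 ≤ β) (hN : Monotone N) (hN0 : ∀ y < 0, N y = 0)
    (gpos : ∀ y > 0, 0 < g y)
    (lim : ∀ h, Tendsto (fun y => (N (y + h) - N y) / g y) atTop (𝓝 h))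
    (rv : ∀ s > 0, Tendsto (fun y => g (y * s) / g y) atTop (𝓝 (s ^ β)))
    (h0 : β = 0 → ∃ x₀, MonotoneOn g (Set.Ici x₀)) : Good N g β 1 := by
  have gpos' : ∀ᶠ y in atTop, 0 < g y := by
    filter_upwards [eventually_gt_atTop 0] with y hy using gpos y hy
  have key : ∃ C > 0, ∃ Y > 0, ∀ z y, Y ≤ z → z ≤ y → g z ≤ C * g y := by
    rcases hβ.eq_or_lt with hb | hb
    · obtain ⟨x₀, hx⟩ := h0 hb.symm
      refine ⟨1, one_pos, max x₀ 1, by positivity, fun z y hz hzy => ?_⟩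
      have hz' := (le_max_left _ _).trans hz
      rw [one_mul]
      exact hx hz' (hz'.trans hzy) hzy
    · let U : ℝ → ℝ := fun y => N (y + 1) - N y
      have mU : Measurable U := (hN.measurable.comp (by fun_prop)).sub hN.measurable
      have l1 : Tendsto (fun y => U y / g y) atTop (𝓝 1) := lim 1
      have hU : ∀ᶠ y in atTop, 1 / 2 * g y < U y ∧ U y < 2 * g y := by
        filter_upwards [gpos', l1.eventually (lt_mem_nhds (show (1 / 2 : ℝ) < 1 by norm_num)),
          l1.eventually (gt_mem_nhds (show (1 : ℝ) < 2 by norm_num))] with y hy f1 f2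
        rw [lt_div_iff₀ hy] at f1
        rw [div_lt_iff₀ hy] at f2
        exact ⟨f1, f2⟩
      have Upos : ∀ᶠ y in atTop, 0 < U y := by
        filter_upwards [hU, gpos'] with y f hy
        linarith [f.1]
      have rvU : ∀ s > 0, Tendsto (fun y => U (y * s) / U y) atTop (𝓝 (s ^ β)) := by
        intro s hs
        have := (scale_lim gpos' l1 rv s hs).div l1 one_ne_zero
        rw [one_mul, div_one] at this
        refine this.congr' ?_
        filter_upwards [Upos, gpos'] with y f hy
        simp only [Pi.div_apply]
        field_simp
      obtain ⟨C, hC, Y, hY, hb⟩ := rv_bound hb mU Upos rvU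
      obtain ⟨Y', hY'⟩ := eventually_atTop.1 hU
      refine ⟨4 * C, by positivity, max Y Y', lt_max_of_lt_left hY, fun z y hz hzy => ?_⟩
      have f1 := hb z y ((le_max_left _ _).trans hz) hzy
      have f2 := (hY' z ((le_max_right _ _).trans hz)).1
      have f3 := (hY' y (((le_max_right _ _).trans hz).trans hzy)).2
      nlinarith
  obtain ⟨C, hC, Y, hY, hb⟩ := key
  have Nnn : ∀ y, 0 ≤ N y := fun y => by
    have h1 := hN (show min y (-1) ≤ y from min_le_left _ _)
    rwa [hN0 _ (by have := min_le_right y (-1); linarith)] at h1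
  refine ⟨hN, hN0, gpos', fun h _ => by rw [one_mul]; exact lim h, rv, fun h hh K hK => ?_⟩
  set K' := max K 1 with hK'
  have hK'1 : 1 ≤ K' := le_max_right _ _
  have hK'0 : 0 < K' := by linarith
  have e1 : ∀ᶠ z in atTop, N (z + h) - N z ≤ (h + 1) * g z := by
    filter_upwards [gpos', (lim h).eventually (gt_mem_nhds (lt_add_one h))] with z hz f
    rw [div_lt_iff₀ hz] at f
    exact f.le
  obtain ⟨Z0, hZ0⟩ := eventually_atTop.1 e1
  set Z := max Z0 Y with hZ
  have hZY : Y ≤ Z := le_max_right _ _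
  have gZ : 0 < g Z := gpos _ (hY.trans_le hZY)
  refine ⟨(h + 1) * C * (K' ^ β + 1) + N (Z + h) * C / g Z, ?_, ?_⟩
  · have := Nnn (Z + h)
    positivity
  filter_upwards [eventually_ge_atTop Z, (rv K' hK'0).eventually (gt_mem_nhds (lt_add_one _))]
    with y hy f z hz
  have hy0 : 0 < y := hY.trans_le (hZY.trans hy)
  have gy := gpos y hy0
  rw [div_lt_iff₀ gy] at f
  have g1 : g Z ≤ C * g y := hb Z y hZY hy
  have t2 : 0 ≤ N (Z + h) * C / g Z * g y := by
    have := Nnn (Z + h)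
    positivity
  have t1 : 0 ≤ (h + 1) * C * (K' ^ β + 1) * g y := by positivity
  rw [add_mul]
  by_cases hzZ : Z ≤ z
  · have f1 := hZ0 z ((le_max_left _ _).trans hzZ)
    have f2 := hb z (y * K') (hZY.trans hzZ) (by
      have := mul_le_mul_of_nonneg_right (le_max_left K 1) hy0.le
      linarith)
    have f3 : (h + 1) * g z ≤ (h + 1) * (C * ((K' ^ β + 1) * g y)) := by
      gcongr
      exact f2.trans (by gcongr)
    linarith
  · push Not at hzZ
    have f1 : N (z + h) ≤ N (Z + h) := hN (by linarith)
    have f2 : N (Z + h) ≤ N (Z + h) * C / g Z * g y := by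
      rw [div_mul_eq_mul_div, le_div_iff₀ gZ]
      have := mul_le_mul_of_nonneg_left g1 (Nnn (Z + h))
      linarith
    linarith [Nnn z]

/-! ### The main theorem -/

theorem stmt0
    (p : ℕ → ℝ) (hp0 : ∀ k, 0 ≤ p k) (hp1 : ∑' k, p k = 1)
    (hpinf : {k | 0 < p k}.Infinite)
    (β : ℝ) (hβ : 0 ≤ β)
    (ℓ : ℝ → ℝ) (hℓpos : ∀ x > 0, 0 < ℓ x)
    (hℓsv : ∀ c > 0, Tendsto (fun x => ℓ (c * x) / ℓ x) atTop (𝓝 1))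
    (h6 : ∀ lam > 0, Tendsto
      (fun t => (rhoJ p 1 (lam * t) - rhoJ p 1 t) / (Real.log t ^ β * ℓ (Real.log t)))
      atTop (𝓝 (Real.log lam)))
    (h60 : β = 0 → (∃ x₀, MonotoneOn ℓ (Set.Ici x₀)) ∧ Tendsto ℓ atTop atTop)
    (j : ℕ) (hj : 2 ≤ j) (lam : ℝ) (hlam : 0 < lam) :
    Tendsto
      (fun t => (rhoJ p j (lam * t) - rhoJ p j t) /
        (Real.log t ^ ((j : ℝ) * β + j - 1) * (ℓ (Real.log t)) ^ j))
      atTop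
      (𝓝 ((Real.Gamma (β + 1)) ^ j / Real.Gamma (j * (β + 1)) * Real.log lam)) := by
  have hs : Summable p := by
    by_contra hcon
    rw [tsum_eq_zero_of_not_summable hcon] at hp1
    exact zero_ne_one hp1
  have hp : ∀ k, p k ≤ 1 := fun k => hp1 ▸ hs.le_tsum k (fun i _ => hp0 i)
  set g : ℝ → ℝ := fun y => y ^ β * ℓ y with hg
  have gpos : ∀ y > 0, 0 < g y := fun y hy => mul_pos (Real.rpow_pos_of_pos hy β) (hℓpos y hy)
  have hNN : ∀ i, ∀ x > 0, ∀ y, NN p i (Real.log x + y) = rhoJ p i (Real.exp y * x) := by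
    intro i x hx y
    rw [NN, Real.exp_add, Real.exp_log hx, mul_comm]
  have lim : ∀ h, Tendsto (fun y => (NN p 1 (y + h) - NN p 1 y) / g y) atTop (𝓝 h) := by
    intro h
    have := (h6 (Real.exp h) (Real.exp_pos h)).comp Real.tendsto_exp_atTop
    rw [Real.log_exp] at this
    refine this.congr fun y => ?_
    simp only [Function.comp, Real.log_exp, NN, Real.exp_add, hg]
    rw [mul_comm (Real.exp h)]
  have rv : ∀ s > 0, Tendsto (fun y => g (y * s) / g y) atTop (𝓝 (s ^ β)) := by
    intro s hs0
    have := (hℓsv s hs0).const_mul (s ^ β)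
    rw [mul_one] at this
    refine this.congr' ?_
    filter_upwards [eventually_gt_atTop 0] with y hy
    have h1 := hℓpos y hy
    have h2 := Real.rpow_pos_of_pos hy β
    simp only [hg]
    rw [Real.mul_rpow hy.le hs0.le, mul_comm s y]
    field_simp
  have base : Good (NN p 1) g β 1 := by
    refine good_base hβ (NN_mono hp0 hp hs 1) (fun y hy => NN_neg hp0 hp 1 hy) gpos lim rv ?_
    intro hb
    obtain ⟨⟨x₀, hx⟩, _⟩ := h60 hb
    refine ⟨x₀, ?_⟩
    have : g = ℓ := by funext y; simp [hg, hb]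
    rwa [this]
  have base' : ∀ δ > 0, Tendsto (fun y => (NN p 1 y - NN p 1 (y - δ)) / g y) atTop (𝓝 δ) := by
    intro δ _
    have := (lim (-δ)).neg
    rw [neg_neg] at this
    refine this.congr fun y => ?_
    rw [← neg_div, neg_sub, sub_eq_add_neg y δ]
  have all : ∀ m : ℕ, Good (NN p (m + 1)) (fun y => y ^ m * g y ^ (m + 1))
      ((m + 1) * β + m) (Real.Gamma (β + 1) ^ (m + 1) / Real.Gamma ((m + 1) * (β + 1))) := by
    intro m
    induction m with
    | zero =>
      have hG := Real.Gamma_pos_of_pos (show 0 < β + 1 by linarith)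
      convert base using 1
      · simp
      · simp
      · simp [hG.ne']
    | succ m ih =>
      have hγ : 0 ≤ ((m : ℝ) + 1) * β + m := by positivity
      have hst := Good.step (a := fun k => -Real.log (p k)) hβ hγ base base' ih
        (NN_mono hp0 hp hs (m + 1 + 1)) (fun y hy => NN_neg hp0 hp (m + 1 + 1) hy) (by
          intro T
          obtain ⟨S, hS⟩ := NN_succ hp0 hp hs T
          refine ⟨S, fun y hy => ⟨?_, hS (m + 1) y hy⟩⟩
          rw [show (1 : ℕ) = 0 + 1 from rfl, hS 0 y hy]
          exact Finset.sum_congr rfl fun k _ => NN_zero p _)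
      have hG1 := Real.Gamma_pos_of_pos (show 0 < ((m : ℝ) + 1) * (β + 1) by positivity)
      convert hst using 1
      · funext y
        ring
      · push_cast
        ring
      · rw [show ((m : ℝ) + 1) * β + m + 1 = (m + 1) * (β + 1) by ring,
          show β + 1 + ((m : ℝ) + 1) * (β + 1) = ((m + 1 : ℕ) + 1) * (β + 1) by push_cast; ring]
        field_simp
        ring
  obtain ⟨m, rfl⟩ : ∃ m, j = m + 1 := ⟨j - 1, by omega⟩
  have hm := all m
  set c := Real.Gamma (β + 1) ^ (m + 1) / Real.Gamma ((m + 1) * (β + 1)) with hc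
  have gmpos : ∀ y > 0, 0 < y ^ m * g y ^ (m + 1) := fun y hy => by
    have := gpos y hy
    positivity
  have fin : ∀ h, Tendsto (fun y => (NN p (m + 1) (y + h) - NN p (m + 1) y) /
      (y ^ m * g y ^ (m + 1))) atTop (𝓝 (c * h)) := by
    intro h
    rcases lt_trichotomy h 0 with hh | hh | hh
    · have tr : Tendsto (fun y : ℝ => y + h) atTop atTop := tendsto_atTop_add_const_right _ _ tendsto_id
      have r1 : Tendsto (fun y => g (y + h) / g y) atTop (𝓝 1) := by
        have a1 := (lim 1).comp tr
        have a2 : Tendsto (fun y => (NN p 1 (y + h + 1) - NN p 1 (y + h)) / g y) atTop (𝓝 1) := by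
          have := (lim (h + 1)).sub (lim h)
          rw [add_sub_cancel_left] at this
          refine this.congr fun y => ?_
          rw [← sub_div, add_assoc]
          ring
        have := a2.div a1 one_ne_zero
        rw [div_one] at this
        refine this.congr' ?_
        filter_upwards [a2.eventually (lt_mem_nhds (zero_lt_one' ℝ)), eventually_gt_atTop 0,
          eventually_gt_atTop (-h)] with y f hy hy'
        have g1 := gpos y hy
        have g2 := gpos (y + h) (by linarith)
        have hD : NN p 1 (y + h + 1) - NN p 1 (y + h) ≠ 0 := by
          intro h0
          rw [h0, zero_div] at f
          exact lt_irrefl _ f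
        simp only [Function.comp, Pi.div_apply]
        field_simp
      have r2 : Tendsto (fun y : ℝ => (y + h) / y) atTop (𝓝 1) := by
        have := (tendsto_inv_atTop_zero.const_mul h).const_add (1 : ℝ)
        rw [mul_zero, add_zero] at this
        refine this.congr' ?_
        filter_upwards [eventually_gt_atTop 0] with y hy
        field_simp
      have r3 := (((hm.lim (-h) (by linarith)).comp tr).mul
        ((r2.pow m).mul (r1.pow (m + 1)))).neg
      simp only [one_pow, mul_one, mul_neg, neg_neg] at r3
      refine r3.congr' ?_
      filter_upwards [eventually_gt_atTop 0, eventually_gt_atTop (-h)] with y hy hy'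
      have g1 := gpos y hy
      have g2 := gpos (y + h) (by linarith)
      have g3 : 0 < y + h := by linarith
      simp only [Function.comp]
      rw [show y + h + -h = y by ring, div_pow, div_pow]
      field_simp
      ring
    · subst hh
      simp
    · exact hm.lim h hh
  have hfinal := (fin (Real.log lam)).comp Real.tendsto_log_atTop
  have ec : (((m + 1 : ℕ) : ℝ)) = (m : ℝ) + 1 := by push_cast; ring
  rw [ec]
  refine hfinal.congr' ?_
  filter_upwards [eventually_gt_atTop 1] with t ht
  have ht0 : 0 < t := by linarith
  have hl : 0 < Real.log t := Real.log_pos ht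
  have e1 := hNN (m + 1) t ht0 (Real.log lam)
  rw [Real.exp_log hlam] at e1
  have e2 := hNN (m + 1) t ht0 0
  rw [Real.exp_zero, one_mul, add_zero] at e2
  simp only [Function.comp]
  rw [e1, e2]
  congr 1
  simp only [hg]
  rw [mul_pow, ← Real.rpow_natCast (Real.log t ^ β) (m + 1), ← Real.rpow_mul hl.le,
    ← mul_assoc, ← Real.rpow_natCast (Real.log t) m, ← Real.rpow_add hl]
  congr 2
  push_cast
  ring
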